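/- Let x^1,…,x^N ∈ X be fixed states with empirical distribution μ^N, let π: X × P(X) → P(U) be any policy, let u^1,…,u^N be mutually independent with u^i ~ π(x^i, μ^N), let P: X × U × P(X) × P(U) → P(X) be any transition function, and write ν̄ := ν^MF(μ^N, π). Then (1/N) Σ_{x∈X} E| Σ_{i=1}^N P(x^i, u^i, μ^N, ν̄)(x) − Σ_{i=1}^N Σ_{u∈U} P(x^i, u, μ^N, ν̄)(x) π(x^i, μ^N)(u) | ≤ √|X| / √N. -/

import Mathlib

/-- A probability distribution on a finite type, viewed as a vector. -/
def IsDist {α : Type*} [Fintype α] (μ : α → ℝ) : Prop :=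
  (∀ a, 0 ≤ μ a) ∧ ∑ a, μ a = 1

/-- Empirical distribution of `x¹,…,x^N`. -/
noncomputable def empDist {α : Type*} [Fintype α] [DecidableEq α] {N : ℕ}
    (x : Fin N → α) : α → ℝ :=
  fun s => (1 / (N : ℝ)) * ∑ i, if x i = s then (1 : ℝ) else 0

/-- Mean-field action distribution `ν^MF(μ,π) = Σ_x π(x,μ) μ(x)`. -/
noncomputable def nuMF {X U : Type*} [Fintype X] [Fintype U]
    (π : X → (X → ℝ) → U → ℝ) (μ : X → ℝ) : U → ℝ :=
  fun u => ∑ x, π x μ u * μ x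

theorem aux_sum_cons {U : Type*} [Fintype U] {n : ℕ} (F : (Fin (n+1) → U) → ℝ) :
    ∑ a, F a = ∑ u : U, ∑ b : Fin n → U, F (Fin.cons u b) := by
  rw [← (Fin.consEquiv (fun _ : Fin (n+1) => U)).sum_comp, Fintype.sum_prod_type]
  rfl

theorem aux_moments {U : Type*} [Fintype U] : ∀ {n : ℕ} (q g : Fin n → U → ℝ)
    (_ : ∀ i, ∑ u, q i u = 1) (_ : ∀ i, ∑ u, q i u * g i u = 0),
    (∑ a : Fin n → U, ∏ j, q j (a j)) = 1 ∧
    (∑ a : Fin n → U, (∏ j, q j (a j)) * ∑ i, g i (a i)) = 0 ∧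
    (∑ a : Fin n → U, (∏ j, q j (a j)) * (∑ i, g i (a i)) ^ 2) =
      ∑ i, ∑ u, q i u * g i u ^ 2 := by
  intro n
  induction n with
  | zero => intro q g _ _; simp
  | succ n ih =>
    intro q g hq hg
    obtain ⟨h1, h2, h3⟩ := ih (fun i => q i.succ) (fun i => g i.succ)
      (fun i => hq i.succ) (fun i => hg i.succ)
    have q0 := hq 0
    have g0 := hg 0
    refine ⟨?_, ?_, ?_⟩
    · rw [aux_sum_cons]
      simp only [Fin.prod_univ_succ, Fin.cons_zero, Fin.cons_succ, ← Finset.mul_sum, h1, mul_one, q0]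
    · rw [aux_sum_cons]
      simp only [Fin.prod_univ_succ, Fin.sum_univ_succ, Fin.cons_zero, Fin.cons_succ]
      have : ∀ u : U, ∑ b : Fin n → U, (q 0 u * ∏ j : Fin n, q j.succ (b j)) *
          (g 0 u + ∑ i : Fin n, g i.succ (b i)) = q 0 u * g 0 u := by
        intro u
        calc _ = q 0 u * g 0 u * (∑ b : Fin n → U, ∏ j : Fin n, q j.succ (b j)) + q 0 u *
              ∑ b : Fin n → U, (∏ j : Fin n, q j.succ (b j)) * ∑ i : Fin n, g i.succ (b i) := by
              rw [Finset.mul_sum, Finset.mul_sum, ← Finset.sum_add_distrib]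
              exact Finset.sum_congr rfl fun b _ => by ring
          _ = _ := by rw [h1, h2]; ring
      simp only [this, g0]
    · rw [aux_sum_cons]
      simp only [Fin.prod_univ_succ, Fin.sum_univ_succ, Fin.cons_zero, Fin.cons_succ]
      have : ∀ u : U, ∑ b : Fin n → U, (q 0 u * ∏ j : Fin n, q j.succ (b j)) *
          (g 0 u + ∑ i : Fin n, g i.succ (b i)) ^ 2 = q 0 u * g 0 u ^ 2 +
            q 0 u * ∑ i : Fin n, ∑ u, q i.succ u * g i.succ u ^ 2 := by
        intro u
        calc _ = q 0 u * g 0 u ^ 2 * (∑ b : Fin n → U, ∏ j : Fin n, q j.succ (b j)) +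
              2 * q 0 u * g 0 u *
              (∑ b : Fin n → U, (∏ j : Fin n, q j.succ (b j)) * ∑ i : Fin n, g i.succ (b i)) +
              q 0 u * ∑ b : Fin n → U, (∏ j : Fin n, q j.succ (b j)) *
                (∑ i : Fin n, g i.succ (b i)) ^ 2 := by
              rw [Finset.mul_sum, Finset.mul_sum, Finset.mul_sum, ← Finset.sum_add_distrib,
                ← Finset.sum_add_distrib]
              exact Finset.sum_congr rfl fun b _ => by ring
          _ = _ := by rw [h1, h2, h3]; ring
      simp only [this, Finset.sum_add_distrib, ← Finset.sum_mul, q0, one_mul]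

theorem aux_jensen {A : Type*} [Fintype A] (w y : A → ℝ) (hw : ∀ a, 0 ≤ w a)
    (h1 : ∑ a, w a = 1) : (∑ a, w a * |y a|) ^ 2 ≤ ∑ a, w a * y a ^ 2 := by
  have h : 0 ≤ ∑ a, w a * (|y a| - ∑ b, w b * |y b|) ^ 2 :=
    Finset.sum_nonneg fun a _ => mul_nonneg (hw a) (sq_nonneg _)
  set M := ∑ b, w b * |y b| with hM
  have e : ∀ c : ℝ, ∑ a, w a * (|y a| - c) ^ 2 =
      ∑ a, w a * y a ^ 2 - 2 * c * (∑ b, w b * |y b|) + c ^ 2 * ∑ a, w a := by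
    intro c
    rw [Finset.mul_sum, Finset.mul_sum, ← Finset.sum_sub_distrib, ← Finset.sum_add_distrib]
    refine Finset.sum_congr rfl fun a _ => ?_
    rw [← sq_abs (y a)]; ring
  rw [e, h1, ← hM] at h
  nlinarith

/-- Jensen and the variance bound. -/
theorem aux_bound {U : Type*} [Fintype U] {n : ℕ} (q f : Fin n → U → ℝ)
    (hq0 : ∀ i u, 0 ≤ q i u) (hq : ∀ i, ∑ u, q i u = 1)
    (hf0 : ∀ i u, 0 ≤ f i u) (hf1 : ∀ i u, f i u ≤ 1) :
    (∑ a : Fin n → U, (∏ j, q j (a j)) * |(∑ i, f i (a i)) - ∑ i, ∑ u, f i u * q i u|) ^ 2 ≤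
      ∑ i, ∑ u, q i u * f i u := by
  set m : Fin n → ℝ := fun i => ∑ u, f i u * q i u with hm
  obtain ⟨h1, -, h3⟩ := aux_moments q (fun i u => f i u - m i) hq (by
    intro i
    simp only [mul_sub, Finset.sum_sub_distrib, ← Finset.sum_mul, hq, one_mul, hm]
    rw [sub_eq_zero]
    exact Finset.sum_congr rfl fun u _ => mul_comm _ _)
  simp only [Finset.sum_sub_distrib] at h3
  have hw : ∀ a : Fin n → U, 0 ≤ ∏ j, q j (a j) := fun a => Finset.prod_nonneg fun j _ => hq0 _ _
  refine (aux_jensen _ _ hw h1).trans ?_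
  rw [h3]
  refine Finset.sum_le_sum fun i _ => ?_
  have e : ∀ c : ℝ, ∑ u, q i u * (f i u - c) ^ 2 =
      ∑ u, q i u * f i u ^ 2 - 2 * c * (∑ u, f i u * q i u) + c ^ 2 * ∑ u, q i u := by
    intro c
    rw [Finset.mul_sum, Finset.mul_sum, ← Finset.sum_sub_distrib, ← Finset.sum_add_distrib]
    exact Finset.sum_congr rfl fun u _ => by ring
  have e2 : ∑ u, f i u * q i u = m i := rfl
  have e3 : ∑ u, q i u * f i u ^ 2 ≤ ∑ u, q i u * f i u :=
    Finset.sum_le_sum fun u _ => mul_le_mul_of_nonneg_left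
      (by nlinarith [hf0 i u, hf1 i u]) (hq0 i u)
  rw [e, hq, e2]
  nlinarith [sq_nonneg (m i)]

theorem aux_empDist {α : Type*} [Fintype α] [DecidableEq α] {N : ℕ} (hN : 0 < N)
    (x : Fin N → α) : IsDist (empDist x) := by
  have hN' : (N : ℝ) ≠ 0 := by positivity
  refine ⟨fun a => ?_, ?_⟩
  · unfold empDist
    exact mul_nonneg (by positivity) (Finset.sum_nonneg fun i _ => by split_ifs <;> norm_num)
  · unfold empDist
    rw [← Finset.mul_sum, Finset.sum_comm]
    simp [hN']

theorem aux_nuMF {X U : Type*} [Fintype X] [Fintype U]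
    (π : X → (X → ℝ) → U → ℝ) (μ : X → ℝ) (hμ : IsDist μ) (hπ : ∀ x, IsDist (π x μ)) :
    IsDist (nuMF π μ) := by
  refine ⟨fun u => Finset.sum_nonneg fun x _ => mul_nonneg ((hπ x).1 u) (hμ.1 x), ?_⟩
  unfold nuMF
  rw [Finset.sum_comm]
  simp only [← Finset.sum_mul, (hπ _).2, one_mul, hμ.2]

/-- with actions sampled mutually independently,
`uⁱ ~ π(xⁱ,μ^N)` (the expectation being the weighted sum over `a : Fin N → U`),
and `ν̄ = ν^MF(μ^N,π)`,
`(1/N) Σ_{s∈X} E|Σᵢ P(xⁱ,uⁱ,μ^N,ν̄)(s) − Σᵢ Σ_u P(xⁱ,u,μ^N,ν̄)(s) π(xⁱ,μ^N)(u)|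
  ≤ √|X|/√N`. -/
theorem transition_action_concentration {X U : Type*}
    [Fintype X] [DecidableEq X] [Fintype U] [DecidableEq U]
    {N : ℕ} (hN : 0 < N) (x : Fin N → X)
    (π : X → (X → ℝ) → U → ℝ)
    (hπ : ∀ x' μ, IsDist μ → IsDist (π x' μ))
    (P : X → U → (X → ℝ) → (U → ℝ) → X → ℝ)
    (hP : ∀ x' u' μ ν, IsDist μ → IsDist ν → IsDist (P x' u' μ ν)) :
    (1 / (N : ℝ)) * ∑ s : X, (∑ a : Fin N → U,
        (∏ j, π (x j) (empDist x) (a j)) *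
          |(∑ i, P (x i) (a i) (empDist x) (nuMF π (empDist x)) s) -
            ∑ i, ∑ u, P (x i) u (empDist x) (nuMF π (empDist x)) s *
              π (x i) (empDist x) u|) ≤
      Real.sqrt (Fintype.card X) / Real.sqrt N := by
  have hμ := aux_empDist hN x
  have hν := aux_nuMF π _ hμ (fun x' => hπ x' _ hμ)
  generalize nuMF π (empDist x) = ν at *
  generalize empDist x = μ at *
  have hPd := fun i u => hP (x i) u μ ν hμ hν
  have hb : ∀ s : X, _ := fun s => aux_bound (fun i u => π (x i) μ u) (fun i u => P (x i) u μ ν s)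
    (fun i u => (hπ (x i) μ hμ).1 u) (fun i => (hπ (x i) μ hμ).2)
    (fun i u => (hPd i u).1 s)
    (fun i u => by
      rw [← (hPd i u).2]
      exact Finset.single_le_sum (fun t _ => (hPd i u).1 t) (Finset.mem_univ s))
  have htot : ∑ s : X, ∑ i, ∑ u, π (x i) μ u * P (x i) u μ ν s = N := by
    rw [Finset.sum_comm]
    have : ∀ i, ∑ s : X, ∑ u, π (x i) μ u * P (x i) u μ ν s = 1 := by
      intro i
      rw [Finset.sum_comm]
      simp only [← Finset.mul_sum, (hPd i _).2, mul_one, (hπ (x i) μ hμ).2]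
    simp [this]
  have hcs := sq_sum_le_card_mul_sum_sq (s := (Finset.univ : Finset X))
    (f := fun s => ∑ a : Fin N → U, (∏ j, π (x j) μ (a j)) *
      |(∑ i, P (x i) (a i) μ ν s) - ∑ i, ∑ u, P (x i) u μ ν s * π (x i) μ u|)
  have hle := Finset.sum_le_sum (fun s (_ : s ∈ (Finset.univ : Finset X)) => hb s)
  rw [htot] at hle
  have hNp : (0 : ℝ) < N := by exact_mod_cast hN
  have hfin := hcs.trans (mul_le_mul_of_nonneg_left hle (Nat.cast_nonneg _))
  have h4 := Real.le_sqrt_of_sq_le hfin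
  rw [Real.sqrt_mul (Nat.cast_nonneg _), Finset.card_univ] at h4
  have h5 := mul_le_mul_of_nonneg_left h4 (show (0 : ℝ) ≤ 1 / N by positivity)
  refine h5.trans (le_of_eq ?_)
  have hs : (0 : ℝ) < Real.sqrt N := Real.sqrt_pos.2 hNp
  have hss := Real.mul_self_sqrt hNp.le
  rw [eq_div_iff hs.ne', mul_assoc, mul_assoc, hss]
  field_simp
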